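/- The disjoint union of stars S_{i_1} ∪ S_{i_2} ∪ ⋯ ∪ S_{i_n} has a prime labeling provided at most one of the stars S_{i_j} satisfies i_j > 15. -/

import Mathlib

namespace SimpleGraph

/-- A *prime labeling* of a graph of order `n` is a bijective labeling of the vertices by
`{1, …, n}` such that the labels of any two adjacent vertices are coprime. -/
def HasPrimeLabeling {V : Type*} [Fintype V] (H : SimpleGraph V) : Prop :=
  ∃ f : V ≃ Fin (Fintype.card V),
    ∀ u w : V, H.Adj u w → Nat.gcd ((f u : ℕ) + 1) ((f w : ℕ) + 1) = 1

/-- The disjoint union of a family of graphs, as a graph on the sigma type: two vertices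
are adjacent exactly when they lie in the same summand and are adjacent there. -/
def disjointUnion {ι : Type*} {V : ι → Type*} (G : ∀ i, SimpleGraph (V i)) :
    SimpleGraph (Σ i, V i) :=
  SimpleGraph.fromRel (fun a b =>
    ∃ (i : ι) (x y : V i), a = ⟨i, x⟩ ∧ b = ⟨i, y⟩ ∧ (G i).Adj x y)

/-- The star `S_i = K_{1,i}`: one center vertex joined to each of `i` leaves. -/
def star' (i : ℕ) : SimpleGraph (Fin 1 ⊕ Fin i) := completeBipartiteGraph (Fin 1) (Fin i)

end SimpleGraph

/-- In the window `a, …, a + k - 1`, the term at position `x` shares the factor `p` with another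
term. -/
def SharesFactor (a k p x : ℕ) : Prop :=
  p ∣ a + x ∧ ∃ y < k, y ≠ x ∧ p ∣ a + y

/-- Checks that however the multiples of the numbers in the list are placed in a window of length
`k`, some position in `c` shares none of these factors with another position. A factor `p` matters
only if the position `i` of its first multiple satisfies `i + p < k`. -/
def survives (k : ℕ) : List ℕ → List ℕ → Bool
  | [], c => !c.isEmpty
  | p :: ps, c => survives k ps c &&
      (List.range (min p (k - p))).all fun i => survives k ps (c.filter fun x => !(x % p == i))

theorem exists_not_sharesFactor {k : ℕ} (a : ℕ) {ps : List ℕ} (hps : ∀ p ∈ ps, 0 < p)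
    {c : List ℕ} (hc : ∀ x ∈ c, x < k) (h : survives k ps c) :
    ∃ x ∈ c, ∀ p ∈ ps, ¬ SharesFactor a k p x := by
  induction ps generalizing c with
  | nil =>
    cases c with
    | nil => simp [survives] at h
    | cons x c => exact ⟨x, by simp⟩
  | cons p ps ih =>
    have ih := fun {c} => ih (c := c) fun q hq => hps q (List.mem_cons_of_mem _ hq)
    have hp : 0 < p := hps p List.mem_cons_self
    simp only [survives, Bool.and_eq_true, List.all_eq_true, List.mem_range] at h
    by_cases hbad : ∃ z < k, SharesFactor a k p z
    · obtain ⟨z, hzk, hz, y, hyk, hyz, hy⟩ := hbad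
      have key : ∀ u, p ∣ a + u → u % p = z % p := fun u hu =>
        Nat.ModEq.add_left_cancel' a
          (((Nat.modEq_zero_iff_dvd).2 hu).trans ((Nat.modEq_zero_iff_dvd).2 hz).symm)
      have hlt : z % p < min p (k - p) := by
        have hyz' := key y hy
        have e1 := Nat.mod_add_div z p
        have e2 := Nat.mod_add_div y p
        have hr := Nat.mod_lt z hp
        rw [hyz'] at e2
        have hne : z / p ≠ y / p := fun h' => hyz (by rw [h'] at e1; omega)
        rcases Nat.lt_or_gt_of_ne hne with h' | h'
        · have := Nat.mul_le_mul_left p (Nat.one_le_of_lt h')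
          omega
        · have := Nat.mul_le_mul_left p (Nat.one_le_of_lt h')
          omega
      obtain ⟨x, hx, hxp⟩ := ih (fun x hx => hc x (List.mem_filter.1 hx).1) (h.2 _ hlt)
      simp only [List.mem_filter, Bool.not_eq_true', beq_eq_false_iff_ne] at hx
      exact ⟨x, hx.1, List.forall_mem_cons.2 ⟨fun hb => hx.2 (key x hb.1), hxp⟩⟩
    · obtain ⟨x, hx, hxp⟩ := ih hc h.1
      exact ⟨x, hx, List.forall_mem_cons.2 ⟨fun hb => hbad ⟨x, hc x hx, hb⟩, hxp⟩⟩

theorem survives_primes {k : ℕ} (hk : 0 < k) (hk' : k ≤ 16) :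
    survives k [2, 3, 5, 7, 11, 13] (List.range k) := by
  interval_cases k <;> decide +kernel

/-- **Pillai's theorem**: among at most `16` consecutive natural numbers, one is coprime to all
the others. -/
theorem exists_coprime_of_consecutive (a : ℕ) {k : ℕ} (hk : 0 < k) (hk' : k ≤ 16) :
    ∃ x < k, ∀ y < k, y ≠ x → Nat.Coprime (a + x) (a + y) := by
  obtain ⟨x, hx, hxp⟩ := exists_not_sharesFactor (k := k) a (by simp)
    (fun x hx => List.mem_range.1 hx) (survives_primes hk hk')
  rw [List.mem_range] at hx
  refine ⟨x, hx, fun y hy hyx => Nat.Coprime.symm ?_⟩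
  by_contra hcop
  obtain ⟨p, hp, hpy, hpx⟩ := Nat.Prime.not_coprime_iff_dvd.1 hcop
  have hp16 : p < 16 := by
    rcases Nat.lt_or_gt_of_ne hyx with h | h
    · have := Nat.le_of_dvd (by omega) (Nat.dvd_sub hpx hpy)
      omega
    · have := Nat.le_of_dvd (by omega) (Nat.dvd_sub hpy hpx)
      omega
  refine hxp p ?_ ⟨hpx, y, hy, hyx, hpy⟩
  interval_cases p <;> first | simp; done | exact absurd hp (by norm_num)

namespace SimpleGraph

theorem HasPrimeLabeling.of_equiv {V : Type*} [Fintype V] {H : SimpleGraph V} {N : ℕ}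
    (f : V ≃ Fin N) (hf : ∀ u w, H.Adj u w → Nat.Coprime ((f u : ℕ) + 1) ((f w : ℕ) + 1)) :
    H.HasPrimeLabeling := by
  obtain rfl : Fintype.card V = N := by simpa using Fintype.card_congr f
  exact ⟨f, hf⟩

theorem disjointUnion_adj {ι : Type*} {V : ι → Type*} {G : ∀ i, SimpleGraph (V i)}
    {a b : Σ i, V i} (h : (disjointUnion G).Adj a b) :
    ∃ (i : ι) (x y : V i), a = ⟨i, x⟩ ∧ b = ⟨i, y⟩ ∧ (G i).Adj x y := by
  obtain ⟨-, h | ⟨i, x, y, rfl, rfl, h⟩⟩ := h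
  · exact h
  · exact ⟨i, y, x, rfl, rfl, h.symm⟩

/-- A star can be labeled by any window of consecutive integers that has a term coprime to all
the others. -/
theorem exists_star'_equiv {m a : ℕ}
    (h : ∃ x < 1 + m, ∀ y < 1 + m, y ≠ x → Nat.Coprime (a + x) (a + y)) :
    ∃ g : Fin 1 ⊕ Fin m ≃ Fin (1 + m),
      ∀ u w, (star' m).Adj u w → Nat.Coprime (a + g u) (a + g w) := by
  obtain ⟨x, hx, hxy⟩ := h
  let g : Fin 1 ⊕ Fin m ≃ Fin (1 + m) :=
    finSumFinEquiv.trans (Equiv.swap (finSumFinEquiv (Sum.inl 0)) ⟨x, hx⟩)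
  have hcenter (i : Fin 1) : g (Sum.inl i) = ⟨x, hx⟩ := by
    simp only [g, Subsingleton.elim i 0, Equiv.trans_apply, Equiv.swap_apply_left]
  have hleaf (i : Fin 1) (j : Fin m) :
      Nat.Coprime (a + g (Sum.inl i)) (a + g (Sum.inr j)) := by
    have hne : g (Sum.inr j) ≠ g (Sum.inl i) := g.injective.ne Sum.inr_ne_inl
    rw [hcenter i] at hne ⊢
    exact hxy _ (g (Sum.inr j)).2 fun h => hne (Fin.ext h)
  refine ⟨g, ?_⟩
  rintro (i | i) (j | j) hadj
  · simp [star'] at hadj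
  · exact hleaf i j
  · exact (hleaf j i).symm
  · simp [star'] at hadj

/-- If only the first star may have more than `15` leaves, then labeling the stars by successive
windows works: the first one gets the center label `1`. -/
theorem exists_sigma_star'_equiv {n : ℕ} (m : Fin n → ℕ) (hm : ∀ j, 15 < m j → (j : ℕ) = 0) :
    ∃ f : (Σ j, Fin 1 ⊕ Fin (m j)) ≃ Fin (∑ j, (1 + m j)), ∀ j u w, (star' (m j)).Adj u w →
      Nat.Coprime ((f ⟨j, u⟩ : ℕ) + 1) ((f ⟨j, w⟩ : ℕ) + 1) := by
  have hwin (j : Fin n) := exists_star'_equiv (m := m j)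
    (a := ∑ i : Fin j, (1 + m (Fin.castLE j.2.le i)) + 1) <| by
      by_cases hj : 15 < m j
      · have hj0 := hm j hj
        obtain ⟨_ | j, hjn⟩ := j
        · exact ⟨0, by omega, by simp⟩
        · simp at hj0
      · exact exists_coprime_of_consecutive _ (by omega) (by omega)
  choose g hg using hwin
  refine ⟨(Equiv.sigmaCongrRight g).trans finSigmaFinEquiv, fun j u w h => ?_⟩
  simpa [finSigmaFinEquiv_apply, add_right_comm] using hg j u w h

end SimpleGraph

theorem exists_perm_map_zero {n : ℕ} {P : Fin n → Prop} (hP : ∀ j j', P j → P j' → j = j') :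
    ∃ e : Equiv.Perm (Fin n), ∀ j, P (e j) → (j : ℕ) = 0 := by
  by_cases h : ∃ j, P j
  · obtain ⟨j₀, hj₀⟩ := h
    let z : Fin n := ⟨0, j₀.pos⟩
    refine ⟨Equiv.swap z j₀, fun j hj => ?_⟩
    have : Equiv.swap z j₀ j = Equiv.swap z j₀ z := by
      rw [Equiv.swap_apply_left]
      exact hP _ _ hj hj₀
    rw [(Equiv.swap z j₀).injective this]
  · exact ⟨Equiv.refl _, fun j hj => absurd ⟨j, hj⟩ h⟩

/-- The disjoint union of stars S_{i_1} ∪ S_{i_2} ∪ ⋯ ∪ S_{i_n} has a prime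
labeling provided at most one of the stars S_{i_j} satisfies i_j > 15. -/
theorem unionOfStars_hasPrimeLabeling (n : ℕ) (il : Fin n → ℕ)
    (h1 : ∀ j, 1 ≤ il j)
    (h15 : ∀ j j', 15 < il j → 15 < il j' → j = j') :
    (SimpleGraph.disjointUnion
      (fun j : Fin n => SimpleGraph.star' (il j))).HasPrimeLabeling := by
  obtain ⟨e, he⟩ := exists_perm_map_zero h15
  obtain ⟨f, hf⟩ := SimpleGraph.exists_sigma_star'_equiv (fun j => il (e j)) he
  refine .of_equiv
    ((Equiv.sigmaCongrLeft (β := fun j => Fin 1 ⊕ Fin (il j)) e).symm.trans f) fun u w huw => ?_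
  obtain ⟨i, x, y, rfl, rfl, h⟩ := SimpleGraph.disjointUnion_adj huw
  obtain ⟨j, rfl⟩ := e.surjective i
  have hsymm (v : Fin 1 ⊕ Fin (il (e j))) :
      (Equiv.sigmaCongrLeft (β := fun j => Fin 1 ⊕ Fin (il j)) e).symm ⟨e j, v⟩ = ⟨j, v⟩ :=
    (Equiv.symm_apply_eq _).2 rfl
  simpa only [Equiv.trans_apply, hsymm] using hf j x y h
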